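/- Let Φ be an Orlicz function and let p, q be reals with 1 < p < p_Φ ≤ q_Φ < q < ∞, where p_Φ, q_Φ are the Matuzewska–Orlicz indices of Φ, and let Ȳ = (Y₀,Y₁) be a compatible couple of Banach spaces. Then there exists a constant C, depending only on Φ, p and q, such that for every y ∈ Σ(Ȳ) and every representation u of y with respect to the couple Ȳ, ∫₀^∞ Φ(t^{−1/p} K(t^{1/p−1/q}, y; Ȳ)) dt ≤ C ∫₀^∞ Φ(t^{−1/p} J(t^{1/p−1/q}, u(t^{1/p−1/q}); Ȳ)) dt (the inequality holding in [0,∞]). -/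

import Mathlib

open MeasureTheory Filter Set

/-- An Orlicz function: continuous, increasing and convex on `[0,∞)`, vanishing at `0`,
and tending to `∞` at `∞`. -/
structure IsOrliczFunction (Φ : ℝ → ℝ) : Prop where
  map_zero : Φ 0 = 0
  continuousOn : ContinuousOn Φ (Set.Ici 0)
  monotoneOn : MonotoneOn Φ (Set.Ici 0)
  convexOn : ConvexOn ℝ (Set.Ici 0) Φ
  tendsto_atTop : Filter.Tendsto Φ Filter.atTop Filter.atTop

/-- The `Δ₂`-condition: `Φ(2t) ≤ C Φ(t)` for all `t ≥ 0` and some constant `C > 0`. -/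
def Delta2 (Φ : ℝ → ℝ) : Prop :=
  ∃ C : ℝ, 0 < C ∧ ∀ t : ℝ, 0 ≤ t → Φ (2 * t) ≤ C * Φ t

/-- `M(t,Φ) = sup_{s>0} Φ(ts)/Φ(s)`. -/
noncomputable def orliczM (Φ : ℝ → ℝ) (t : ℝ) : ℝ :=
  sSup {r : ℝ | ∃ s : ℝ, 0 < s ∧ r = Φ (t * s) / Φ s}

/-- `p` and `q` are the Matuzewska–Orlicz indices of `Φ`:
`p = lim_{t→0⁺} log M(t,Φ)/log t` and `q = lim_{t→∞} log M(t,Φ)/log t`. -/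
def HasMatuzewskaOrliczIndices (Φ : ℝ → ℝ) (p q : ℝ) : Prop :=
  Filter.Tendsto (fun t : ℝ => Real.log (orliczM Φ t) / Real.log t)
      (nhdsWithin 0 (Set.Ioi 0)) (nhds p) ∧
  Filter.Tendsto (fun t : ℝ => Real.log (orliczM Φ t) / Real.log t)
      Filter.atTop (nhds q)
section Couple

variable {E : Type*} [AddCommGroup E] [Module ℝ E] [TopologicalSpace E]
variable {X₀ X₁ Z : Type*}
variable [NormedAddCommGroup X₀] [NormedSpace ℝ X₀]
variable [NormedAddCommGroup X₁] [NormedSpace ℝ X₁]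
variable [NormedAddCommGroup Z] [NormedSpace ℝ Z]

/-- `x` belongs to the sum `X₀ + X₁` of the couple (embedded in `E` via `i₀, i₁`). -/
def InSigma (i₀ : X₀ →L[ℝ] E) (i₁ : X₁ →L[ℝ] E) (x : E) : Prop :=
  ∃ a b, x = i₀ a + i₁ b

/-- `x` belongs to the intersection `X₀ ∩ X₁` of the couple. -/
def InDelta (i₀ : X₀ →L[ℝ] E) (i₁ : X₁ →L[ℝ] E) (x : E) : Prop :=
  ∃ a b, i₀ a = x ∧ i₁ b = x

/-- The K-functional of the couple: `K(t,x) = inf {‖a‖ + t‖b‖ : x = a + b}`. -/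
noncomputable def Kfun (i₀ : X₀ →L[ℝ] E) (i₁ : X₁ →L[ℝ] E) (t : ℝ) (x : E) : ℝ :=
  sInf {r : ℝ | ∃ a b, x = i₀ a + i₁ b ∧ r = ‖a‖ + t * ‖b‖}

/-- The J-functional of the couple: `J(t,x) = max (‖x‖_{X₀}, t‖x‖_{X₁})` for `x ∈ Δ`. -/
noncomputable def Jfun (i₀ : X₀ →L[ℝ] E) (i₁ : X₁ →L[ℝ] E) (t : ℝ) (x : E) : ℝ :=
  sInf {r : ℝ | ∃ a b, i₀ a = x ∧ i₁ b = x ∧ r = max ‖a‖ (t * ‖b‖)}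

/-- `Z` (embedded in `E` via `j`) is an intermediate space of the couple `(X₀, X₁)`:
the inclusions `Δ ⊆ Z ⊆ Σ` are continuous (`‖·‖_Δ = J(1,·)` and `‖·‖_Σ = K(1,·)`). -/
def IsIntermediate (i₀ : X₀ →L[ℝ] E) (i₁ : X₁ →L[ℝ] E) (j : Z →L[ℝ] E) : Prop :=
  (∃ c : ℝ, 0 < c ∧ ∀ x : E, InDelta i₀ i₁ x →
      ∃ z : Z, j z = x ∧ ‖z‖ ≤ c * Jfun i₀ i₁ 1 x) ∧
  (∃ c : ℝ, 0 < c ∧ ∀ z : Z, InSigma i₀ i₁ (j z) ∧ Kfun i₀ i₁ 1 (j z) ≤ c * ‖z‖)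

/-- `Z` belongs to the class `C_K(θ, (X₀,X₁))` with constant `C`. -/
def ClassCK (i₀ : X₀ →L[ℝ] E) (i₁ : X₁ →L[ℝ] E) (j : Z →L[ℝ] E) (θ C : ℝ) : Prop :=
  ∀ z : Z, ∀ t : ℝ, 0 < t → Kfun i₀ i₁ t (j z) ≤ C * t ^ θ * ‖z‖

/-- `Z` belongs to the class `C_J(θ, (X₀,X₁))` with constant `C`. -/
def ClassCJ (i₀ : X₀ →L[ℝ] E) (i₁ : X₁ →L[ℝ] E) (j : Z →L[ℝ] E) (θ C : ℝ) : Prop :=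
  ∀ z : Z, InDelta i₀ i₁ (j z) → ∀ t : ℝ, 0 < t →
    ‖z‖ ≤ C * t ^ (-θ) * Jfun i₀ i₁ t (j z)

end Couple

/-- `u : (0,∞) → Δ(X̄)` is a representation of `y` with respect to the couple `(X₀,X₁)`:
`u` is strongly measurable with values in `Δ`, and `y = ∫₀^∞ u(t) dt/t` with the improper
integral converging in `Σ(X̄)` (whose norm is `K(1,·)`). -/
structure IsRepresentation
    {E X₀ X₁ : Type*} [AddCommGroup E] [Module ℝ E] [TopologicalSpace E]
    [NormedAddCommGroup X₀] [NormedSpace ℝ X₀]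
    [NormedAddCommGroup X₁] [NormedSpace ℝ X₁]
    (i₀ : X₀ →L[ℝ] E) (i₁ : X₁ →L[ℝ] E) (y : E) (u : ℝ → E) : Prop where
  mem_delta : ∀ t : ℝ, 0 < t → InDelta i₀ i₁ (u t)
  meas₁ : ∃ u₁ : ℝ → X₁, (∀ t : ℝ, 0 < t → i₁ (u₁ t) = u t) ∧
    MeasureTheory.AEStronglyMeasurable u₁ (MeasureTheory.volume.restrict (Set.Ioi 0))
  repr₀ : ∃ u₀ : ℝ → X₀,
    (∀ t : ℝ, 0 < t → i₀ (u₀ t) = u t) ∧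
    MeasureTheory.AEStronglyMeasurable u₀ (MeasureTheory.volume.restrict (Set.Ioi 0)) ∧
    (∀ a b : ℝ, 0 < a → IntervalIntegrable (fun t => t⁻¹ • u₀ t) MeasureTheory.volume a b) ∧
    (∀ a b : ℝ, 0 < a → InSigma i₀ i₁ (y - i₀ (∫ t in a..b, t⁻¹ • u₀ t))) ∧
    Filter.Tendsto
      (fun ab : ℝ × ℝ => Kfun i₀ i₁ 1 (y - i₀ (∫ t in ab.1..ab.2, t⁻¹ • u₀ t)))
      ((nhdsWithin (0:ℝ) (Set.Ioi 0)) ×ˢ (Filter.atTop : Filter ℝ)) (nhds 0)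


lemma orl_nonneg {Φ : ℝ → ℝ} (h : IsOrliczFunction Φ) {s : ℝ} (hs : 0 ≤ s) : 0 ≤ Φ s := by
  have := h.monotoneOn (mem_Ici.2 le_rfl) (mem_Ici.2 hs) hs
  rwa [h.map_zero] at this

lemma orl_bdd {Φ : ℝ → ℝ} {t : ℝ} (h : orliczM Φ t ≠ 0) {s : ℝ} (hs : 0 < s) :
    Φ (t * s) / Φ s ≤ orliczM Φ t := by
  unfold orliczM at *
  apply le_csSup
  · by_contra hb
    exact h (Real.sSup_of_not_bddAbove hb)
  · exact ⟨s, hs, rfl⟩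

lemma orl_pos {Φ : ℝ → ℝ} (h : IsOrliczFunction Φ) {T : ℝ} (hT : 1 < T)
    (hM : orliczM Φ T ≠ 0) {s : ℝ} (hs : 0 < s) : 0 < Φ s := by
  by_contra hneg
  have hs0 : Φ s = 0 := le_antisymm (not_lt.1 hneg) (orl_nonneg h hs.le)
  -- zero set
  obtain ⟨R, hR⟩ : ∃ R : ℝ, ∀ x, R ≤ x → 1 ≤ Φ x := by
    have := h.tendsto_atTop.eventually_ge_atTop 1
    exact eventually_atTop.1 this
  have hsR : s < R := by
    by_contra hc
    have := hR s (not_lt.1 hc)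
    linarith
  have hcomp : IsCompact (Icc 0 R ∩ Φ ⁻¹' {0}) := by
    apply IsCompact.of_isClosed_subset (isCompact_Icc (a := (0:ℝ)) (b := R)) _ inter_subset_left
    exact (h.continuousOn.mono Icc_subset_Ici_self).preimage_isClosed_of_isClosed isClosed_Icc
      isClosed_singleton
  obtain ⟨z, ⟨⟨⟨hz0, hzR⟩, hz⟩, hgr⟩⟩ := hcomp.exists_isGreatest ⟨s, ⟨⟨hs.le, hsR.le⟩, hs0⟩⟩
  have hzs : s ≤ z := hgr ⟨⟨hs.le, hsR.le⟩, hs0⟩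
  have hzpos : 0 < z := hs.trans_le hzs
  have hz : Φ z = 0 := hz
  have hpos : ∀ x, z < x → 0 < Φ x := by
    intro x hx
    rcases le_total x R with hxR | hxR
    · rcases (orl_nonneg h (hz0.trans hx.le)).eq_or_lt with he | he
      · exact absurd (hgr ⟨⟨hz0.trans hx.le, hxR⟩, he.symm⟩) (not_le.2 hx)
      · exact he
    · linarith [hR x hxR]
  have hc1 : ContinuousAt Φ z := h.continuousOn.continuousAt (Ici_mem_nhds hzpos)
  have hTz : 0 < T * z := by positivity
  have hc2 : ContinuousAt (fun x => Φ (T * x)) z :=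
    ContinuousAt.comp (f := fun x => T * x) (h.continuousOn.continuousAt (Ici_mem_nhds hTz))
      (by fun_prop)
  have hle : Φ (T * z) ≤ orliczM Φ T * Φ z := by
    refine le_of_tendsto_of_tendsto (b := nhdsWithin z (Ioi z))
      (hc2.mono_left nhdsWithin_le_nhds)
      ((continuousAt_const.mul hc1).mono_left nhdsWithin_le_nhds) ?_
    filter_upwards [self_mem_nhdsWithin] with x hx
    have hx : z < x := hx
    have := orl_bdd hM (hzpos.trans hx)
    rwa [div_le_iff₀ (hpos x hx)] at this
  have := hpos (T * z) (by nlinarith)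
  rw [hz] at hle
  linarith

lemma orl_growth {Φ : ℝ → ℝ} (h : IsOrliczFunction Φ) {pΦ qΦ p' q' : ℝ}
    (hMO : HasMatuzewskaOrliczIndices Φ pΦ qΦ) (hp0 : 0 < p') (hp : p' < pΦ) (hq0 : 0 < qΦ)
    (hq : qΦ < q') :
    ∃ A : ℝ, 0 < A ∧ ∀ x s : ℝ, 0 < x → 0 ≤ s →
      (x ≤ 1 → Φ (x * s) ≤ A * x ^ p' * Φ s) ∧ (1 ≤ x → Φ (x * s) ≤ A * x ^ q' * Φ s) := by
  obtain ⟨h1, h2⟩ := hMO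
  -- near infinity
  obtain ⟨T, hT1, hTb⟩ : ∃ T : ℝ, 1 < T ∧ ∀ t, T ≤ t → orliczM Φ t ≠ 0 ∧
      orliczM Φ t ≤ t ^ q' := by
    have e1 := h2.eventually (Ioo_mem_nhds hq0 hq)
    obtain ⟨T, hT⟩ := eventually_atTop.1 e1
    refine ⟨max T 2, lt_of_lt_of_le one_lt_two (le_max_right _ _), fun t ht => ?_⟩
    have ht2 : 2 ≤ t := (le_max_right _ _).trans ht
    obtain ⟨ha, hb⟩ := hT t ((le_max_left _ _).trans ht)
    have hM : orliczM Φ t ≠ 0 := by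
      intro h0; rw [h0] at ha; simp at ha
    refine ⟨hM, ?_⟩
    have hlog : 0 < Real.log t := Real.log_pos (by linarith)
    rw [div_lt_iff₀ hlog] at hb
    calc orliczM Φ t ≤ |orliczM Φ t| := le_abs_self _
      _ = Real.exp (Real.log (orliczM Φ t)) := (Real.exp_log_eq_abs hM).symm
      _ ≤ Real.exp (Real.log t * q') := Real.exp_le_exp.2 (by linarith)
      _ = t ^ q' := (Real.rpow_def_of_pos (by linarith) _).symm
  have hpos : ∀ s, 0 < s → 0 < Φ s := fun s hs => orl_pos h hT1 (hTb T le_rfl).1 hs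
  obtain ⟨r, hr0, hr1, hrb⟩ : ∃ r : ℝ, 0 < r ∧ r < 1 ∧ ∀ t, 0 < t → t < r → orliczM Φ t ≠ 0 ∧
      orliczM Φ t ≤ t ^ p' := by
    have e1 := h1.eventually (Ioi_mem_nhds hp)
    obtain ⟨r, hr0, hr⟩ := mem_nhdsGT_iff_exists_Ioo_subset.1 e1
    have hr0 : 0 < r := hr0
    refine ⟨min r (1/2), by positivity, lt_of_le_of_lt (min_le_right _ _) (by norm_num),
      fun t ht0 ht => ?_⟩
    have ha : p' < Real.log (orliczM Φ t) / Real.log t :=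
      hr ⟨ht0, ht.trans_le (min_le_left _ _)⟩
    have ht1 : t < 1 := by
      have := ht.trans_le (min_le_right _ _); linarith
    have hM : orliczM Φ t ≠ 0 := by
      intro h0; rw [h0] at ha; simp at ha; linarith
    refine ⟨hM, ?_⟩
    have hlog : Real.log t < 0 := Real.log_neg ht0 ht1
    rw [lt_div_iff_of_neg hlog] at ha
    calc orliczM Φ t ≤ |orliczM Φ t| := le_abs_self _
      _ = Real.exp (Real.log (orliczM Φ t)) := (Real.exp_log_eq_abs hM).symm
      _ ≤ Real.exp (Real.log t * p') := Real.exp_le_exp.2 (by linarith)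
      _ = t ^ p' := (Real.rpow_def_of_pos (by linarith) _).symm
  have key : ∀ t s B, 0 < s → orliczM Φ t ≠ 0 → orliczM Φ t ≤ B → Φ (t * s) ≤ B * Φ s := by
    intro t s B hs hM hB
    have := (orl_bdd hM hs).trans hB
    rwa [div_le_iff₀ (hpos s hs)] at this
  have hT0 : 0 < T := by linarith
  have hq'0 : 0 < q' := hq0.trans hq
  have hTq : 1 ≤ T ^ q' := Real.one_le_rpow hT1.le hq'0.le
  have hrp : 1 ≤ (r⁻¹) ^ p' := Real.one_le_rpow (one_le_inv_iff₀.2 ⟨hr0, hr1.le⟩) hp0.le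
  refine ⟨T ^ q' + (r⁻¹) ^ p', by positivity, fun x s hx hs => ?_⟩
  rcases hs.eq_or_lt with rfl | hs
  · simp [h.map_zero]
  have hΦs := hpos s hs
  constructor
  · intro hx1
    rcases lt_or_ge x r with hxr | hxr
    · obtain ⟨a, b⟩ := hrb x hx hxr
      refine key x s _ hs a (b.trans ?_)
      have : 0 < x ^ p' := by positivity
      nlinarith
    · have m : Φ (x * s) ≤ Φ s := h.monotoneOn (mem_Ici.2 (by positivity)) (mem_Ici.2 hs.le)
        (by nlinarith)
      have e : 1 ≤ (r⁻¹) ^ p' * x ^ p' := by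
        rw [← Real.mul_rpow (by positivity) hx.le]
        apply Real.one_le_rpow _ hp0.le
        rw [inv_mul_eq_div, one_le_div hr0]; exact hxr
      have : 0 < x ^ p' := by positivity
      have e2 : 1 ≤ (T ^ q' + (r⁻¹) ^ p') * x ^ p' := by nlinarith
      nlinarith
  · intro hx1
    have hxq : 1 ≤ x ^ q' := Real.one_le_rpow hx1 hq'0.le
    rcases lt_or_ge x T with hxr | hxr
    · have m : Φ (x * s) ≤ Φ (T * s) := h.monotoneOn (mem_Ici.2 (by positivity))
        (mem_Ici.2 (by positivity)) (by nlinarith)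
      have m2 := key T s _ hs (hTb T le_rfl).1 (hTb T le_rfl).2
      have e2 : T ^ q' ≤ (T ^ q' + (r⁻¹) ^ p') * x ^ q' := by nlinarith
      nlinarith
    · obtain ⟨a, b⟩ := hTb x hxr
      refine key x s _ hs a (b.trans ?_)
      nlinarith

section KB
variable {E : Type*} [AddCommGroup E] [Module ℝ E] [TopologicalSpace E]
variable {X₀ X₁ : Type*}
variable [NormedAddCommGroup X₀] [NormedSpace ℝ X₀]
variable [NormedAddCommGroup X₁] [NormedSpace ℝ X₁]

lemma Kfun_bddBelow (i₀ : X₀ →L[ℝ] E) (i₁ : X₁ →L[ℝ] E) {t : ℝ} (ht : 0 ≤ t) (x : E) :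
    BddBelow {r : ℝ | ∃ a b, x = i₀ a + i₁ b ∧ r = ‖a‖ + t * ‖b‖} := by
  refine ⟨0, ?_⟩
  rintro r ⟨a, b, -, rfl⟩
  positivity

lemma Kfun_nonneg (i₀ : X₀ →L[ℝ] E) (i₁ : X₁ →L[ℝ] E) {t : ℝ} (ht : 0 ≤ t) (x : E) :
    0 ≤ Kfun i₀ i₁ t x := by
  apply Real.sInf_nonneg
  rintro r ⟨a, b, -, rfl⟩
  positivity

lemma Kfun_add_le (i₀ : X₀ →L[ℝ] E) (i₁ : X₁ →L[ℝ] E) {t : ℝ} (ht : 0 ≤ t) (x : E)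
    (hx : InSigma i₀ i₁ x) (c : X₀) (d : X₁) :
    Kfun i₀ i₁ t (x + (i₀ c + i₁ d)) ≤ max 1 t * Kfun i₀ i₁ 1 x + (‖c‖ + t * ‖d‖) := by
  have hm : 0 < max 1 t := lt_max_of_lt_left one_pos
  rw [← sub_le_iff_le_add, ← div_le_iff₀' hm]
  apply le_csInf
  · obtain ⟨a, b, h⟩ := hx
    exact ⟨_, a, b, h, rfl⟩
  rintro r ⟨a, b, h, rfl⟩
  rw [div_le_iff₀' hm, sub_le_iff_le_add]
  have h1 : Kfun i₀ i₁ t (x + (i₀ c + i₁ d)) ≤ ‖a + c‖ + t * ‖b + d‖ := by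
    apply csInf_le (Kfun_bddBelow i₀ i₁ ht _)
    refine ⟨a + c, b + d, ?_, rfl⟩
    rw [h, map_add, map_add]; abel
  have h2 := norm_add_le a c
  have h3 := mul_le_mul_of_nonneg_left (norm_add_le b d) ht
  have h4 : ‖a‖ ≤ max 1 t * ‖a‖ := le_mul_of_one_le_left (norm_nonneg _) (le_max_left _ _)
  have h5 : t * ‖b‖ ≤ max 1 t * ‖b‖ := mul_le_mul_of_nonneg_right (le_max_right _ _) (norm_nonneg _)
  nlinarith

lemma Jfun_eq (i₀ : X₀ →L[ℝ] E) (i₁ : X₁ →L[ℝ] E) (h₀ : Function.Injective i₀)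
    (h₁ : Function.Injective i₁) (t : ℝ) (a : X₀) (b : X₁) (x : E) (ha : i₀ a = x)
    (hb : i₁ b = x) : Jfun i₀ i₁ t x = max ‖a‖ (t * ‖b‖) := by
  unfold Jfun
  have : {r : ℝ | ∃ a b, i₀ a = x ∧ i₁ b = x ∧ r = max ‖a‖ (t * ‖b‖)} =
      {max ‖a‖ (t * ‖b‖)} := by
    ext r
    simp only [mem_setOf_eq, mem_singleton_iff]
    constructor
    · rintro ⟨a', b', h1, h2, rfl⟩
      rw [h₀ (h1.trans ha.symm), h₁ (h2.trans hb.symm)]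
    · rintro rfl
      exact ⟨a, b, ha, hb, rfl⟩
  rw [this, csInf_singleton]

lemma int_eq [T2Space E] [CompleteSpace X₀] [CompleteSpace X₁]
    (i₀ : X₀ →L[ℝ] E) (i₁ : X₁ →L[ℝ] E) {μ : Measure ℝ} (f₀ : ℝ → X₀) (f₁ : ℝ → X₁)
    (hf₀ : Integrable f₀ μ) (hf₁ : Integrable f₁ μ) (h : ∀ᵐ t ∂μ, i₀ (f₀ t) = i₁ (f₁ t)) :
    i₀ (∫ t, f₀ t ∂μ) = i₁ (∫ t, f₁ t ∂μ) := by
  let D : Submodule ℝ (X₀ × X₁) :=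
    { carrier := {z | i₀ z.1 = i₁ z.2}
      add_mem' := by
        intro a b ha hb
        simp only [mem_setOf_eq] at *
        simp [ha, hb]
      zero_mem' := by simp
      smul_mem' := by
        intro c a ha
        simp only [mem_setOf_eq] at *
        simp [ha] }
  have hD : IsClosed (D : Set (X₀ × X₁)) :=
    isClosed_eq (i₀.continuous.comp continuous_fst) (i₁.continuous.comp continuous_snd)
  haveI : IsClosed (D : Set (X₀ × X₁)) := hD
  have hint : Integrable (fun t => (f₀ t, f₁ t)) μ := hf₀.prodMk hf₁
  have key : D.mkQL (∫ t, (f₀ t, f₁ t) ∂μ) = 0 := by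
    rw [← ContinuousLinearMap.integral_comp_comm _ hint]
    apply integral_eq_zero_of_ae
    filter_upwards [h] with t ht
    simpa using (Submodule.Quotient.mk_eq_zero D).2 (show (f₀ t, f₁ t) ∈ D from ht)
  rw [integral_pair hf₀ hf₁] at key
  exact (Submodule.Quotient.mk_eq_zero D).1 key

lemma K_bound [T2Space E] [CompleteSpace X₀] [CompleteSpace X₁]
    (i₀ : X₀ →L[ℝ] E) (i₁ : X₁ →L[ℝ] E) (y : E) (u : ℝ → E) (u₀ : ℝ → X₀) (u₁ : ℝ → X₁)
    (e₁ : ∀ t : ℝ, 0 < t → i₁ (u₁ t) = u t)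
    (m₁ : AEStronglyMeasurable u₁ (volume.restrict (Ioi 0)))
    (e₀ : ∀ t : ℝ, 0 < t → i₀ (u₀ t) = u t)
    (I₀ : ∀ a b : ℝ, 0 < a → IntervalIntegrable (fun t => t⁻¹ • u₀ t) volume a b)
    (S : ∀ a b : ℝ, 0 < a → InSigma i₀ i₁ (y - i₀ (∫ t in a..b, t⁻¹ • u₀ t)))
    (L : Tendsto (fun ab : ℝ × ℝ => Kfun i₀ i₁ 1 (y - i₀ (∫ t in ab.1..ab.2, t⁻¹ • u₀ t)))
      ((nhdsWithin (0:ℝ) (Ioi 0)) ×ˢ (atTop : Filter ℝ)) (nhds 0))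
    (s : ℝ) (hs : 0 < s) (j : ℝ → ℝ)
    (hj : ∀ᵐ r ∂(volume.restrict (Ioi 0)), j r = max ‖u₀ r‖ (r * ‖u₁ r‖))
    (hint : IntegrableOn (fun r => min 1 (s / r) * j r / r) (Ioi 0)) :
    Kfun i₀ i₁ s y ≤ ∫ r in Ioi 0, min 1 (s / r) * j r / r := by
  have hae : ∀ᵐ r ∂(volume.restrict (Ioi (0:ℝ))), 0 < r := ae_restrict_mem measurableSet_Ioi
  have hnn : 0 ≤ᵐ[volume.restrict (Ioi (0:ℝ))] fun r => min 1 (s / r) * j r / r := by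
    filter_upwards [hj, hae] with r h1 h2
    rw [h1]
    have : 0 ≤ max ‖u₀ r‖ (r * ‖u₁ r‖) := le_max_of_le_left (norm_nonneg _)
    positivity
  have main : ∀ a b : ℝ, 0 < a → a < s → s < b → Kfun i₀ i₁ s y ≤
      max 1 s * Kfun i₀ i₁ 1 (y - i₀ (∫ t in a..b, t⁻¹ • u₀ t)) +
        ∫ r in Ioi 0, min 1 (s / r) * j r / r := by
    intro a b ha has hsb
    have sub1 : Ioc a s ⊆ Ioi (0:ℝ) := fun x hx => ha.trans hx.1
    have sub2 : Ioc s b ⊆ Ioi (0:ℝ) := fun x hx => hs.trans hx.1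
    have int1 : IntegrableOn (fun r => min 1 (s / r) * j r / r) (Ioc a s) := hint.mono_set sub1
    have int2 : IntegrableOn (fun r => min 1 (s / r) * j r / r) (Ioc s b) := hint.mono_set sub2
    have b2 : ∀ᵐ r ∂(volume.restrict (Ioc s b)),
        s * ‖r⁻¹ • u₁ r‖ ≤ min 1 (s / r) * j r / r := by
      filter_upwards [ae_restrict_of_ae_restrict_of_subset sub2 hj,
        ae_restrict_mem measurableSet_Ioc] with r h1 h2
      have hr : 0 < r := hs.trans h2.1
      have : r * ‖u₁ r‖ ≤ j r := h1 ▸ le_max_right _ _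
      rw [min_eq_right ((div_le_one hr).2 h2.1.le), norm_smul, Real.norm_of_nonneg (by positivity)]
      calc s * (r⁻¹ * ‖u₁ r‖) = s / r * (r * ‖u₁ r‖) / r := by field_simp
        _ ≤ _ := by gcongr
    have b1 : ∀ᵐ r ∂(volume.restrict (Ioc a s)),
        ‖r⁻¹ • u₀ r‖ ≤ min 1 (s / r) * j r / r := by
      filter_upwards [ae_restrict_of_ae_restrict_of_subset sub1 hj,
        ae_restrict_mem measurableSet_Ioc] with r h1 h2
      have hr : 0 < r := ha.trans h2.1
      have : ‖u₀ r‖ ≤ j r := h1 ▸ le_max_left _ _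
      rw [min_eq_left ((one_le_div hr).2 h2.2), norm_smul, Real.norm_of_nonneg (by positivity)]
      calc r⁻¹ * ‖u₀ r‖ = 1 * ‖u₀ r‖ / r := by field_simp
        _ ≤ _ := by gcongr
    have I₁ : IntegrableOn (fun r => r⁻¹ • u₁ r) (Ioc s b) := by
      refine Integrable.mono' (int2.const_mul s⁻¹) ?_ ?_
      · exact (measurable_inv.aestronglyMeasurable).smul (m₁.mono_measure (Measure.restrict_mono sub2 le_rfl))
      · filter_upwards [b2] with r hr
        rwa [inv_mul_eq_div, le_div_iff₀' hs]
    have I₀' : IntegrableOn (fun r => r⁻¹ • u₀ r) (Ioc s b) :=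
      (intervalIntegrable_iff_integrableOn_Ioc_of_le hsb.le).1 (I₀ s b hs)
    have eq := int_eq i₀ i₁ _ _ I₀' I₁ (by
      filter_upwards [ae_restrict_mem measurableSet_Ioc] with r h2
      rw [map_smul, map_smul, e₀ r (hs.trans h2.1), e₁ r (hs.trans h2.1)])
    have split : ∫ t in a..b, t⁻¹ • u₀ t = (∫ t in Ioc a s, t⁻¹ • u₀ t) +
        ∫ t in Ioc s b, t⁻¹ • u₀ t := by
      rw [← intervalIntegral.integral_add_adjacent_intervals (I₀ a s ha) (I₀ s b hs),
        intervalIntegral.integral_of_le has.le, intervalIntegral.integral_of_le hsb.le]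
    have hy : y = (y - i₀ (∫ t in a..b, t⁻¹ • u₀ t)) +
        (i₀ (∫ t in Ioc a s, t⁻¹ • u₀ t) + i₁ (∫ t in Ioc s b, t⁻¹ • u₁ t)) := by
      rw [split, map_add, eq]; abel
    have n1 : ‖∫ t in Ioc a s, t⁻¹ • u₀ t‖ ≤ ∫ r in Ioc a s, min 1 (s / r) * j r / r :=
      norm_integral_le_of_norm_le int1 b1
    have n2 : s * ‖∫ t in Ioc s b, t⁻¹ • u₁ t‖ ≤ ∫ r in Ioc s b, min 1 (s / r) * j r / r := by
      calc s * ‖∫ t in Ioc s b, t⁻¹ • u₁ t‖ ≤ s * ∫ t in Ioc s b, ‖t⁻¹ • u₁ t‖ := by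
            gcongr; exact norm_integral_le_integral_norm _
        _ = ∫ t in Ioc s b, s * ‖t⁻¹ • u₁ t‖ := (integral_const_mul _ _).symm
        _ ≤ _ := integral_mono_ae (I₁.norm.const_mul s) int2 b2
    have n3 : (∫ r in Ioc a s, min 1 (s / r) * j r / r) +
        (∫ r in Ioc s b, min 1 (s / r) * j r / r) ≤ ∫ r in Ioi 0, min 1 (s / r) * j r / r := by
      rw [← setIntegral_union (Ioc_disjoint_Ioc_of_le le_rfl) measurableSet_Ioc int1 int2]
      exact setIntegral_mono_set hint hnn (Eventually.of_forall (union_subset sub1 sub2))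
    have := Kfun_add_le i₀ i₁ hs.le _ (S a b ha) (∫ t in Ioc a s, t⁻¹ • u₀ t)
      (∫ t in Ioc s b, t⁻¹ • u₁ t)
    rw [← hy] at this
    linarith
  have T2 := (L.const_mul (max 1 s)).add_const (∫ r in Ioi 0, min 1 (s / r) * j r / r)
  rw [mul_zero, zero_add] at T2
  refine ge_of_tendsto T2 ?_
  have ev1 : ∀ᶠ a in nhdsWithin (0:ℝ) (Ioi 0), 0 < a ∧ a < s :=
    Ioo_mem_nhdsGT hs
  filter_upwards [ev1.prod_mk (eventually_gt_atTop s)] with ab hab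
  exact main ab.1 ab.2 hab.1.1 hab.1.2 hab.2
end KB

lemma orl_cont {Φ : ℝ → ℝ} (h : IsOrliczFunction Φ) : Continuous fun x => Φ (max x 0) :=
  h.continuousOn.comp_continuous (by fun_prop) (fun _ => mem_Ici.2 (le_max_right _ _))

lemma orl_linear {Φ : ℝ → ℝ} (h : IsOrliczFunction Φ) :
    ∃ R : ℝ, 0 < R ∧ ∀ x, 0 ≤ x → x ≤ R + R * Φ x := by
  obtain ⟨R, hR⟩ := eventually_atTop.1
    ((h.tendsto_atTop.eventually_ge_atTop 1).and (eventually_gt_atTop 0))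
  obtain ⟨hR1, hR0⟩ := hR R le_rfl
  refine ⟨R, hR0, fun x hx => ?_⟩
  have hn := orl_nonneg h hx
  rcases le_total x R with hxR | hxR
  · nlinarith
  have hx0 : 0 < x := hR0.trans_le hxR
  have := h.convexOn.2 (mem_Ici.2 hx) (mem_Ici.2 (le_refl (0:ℝ)))
    (show 0 ≤ R / x by positivity)
    (show 0 ≤ 1 - R / x by rw [sub_nonneg, div_le_one hx0]; exact hxR) (by ring)
  simp only [smul_eq_mul, mul_zero, add_zero, h.map_zero] at this
  rw [div_mul_cancel₀ _ hx0.ne'] at this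
  have h2 : 1 ≤ R / x * Φ x := hR1.trans this
  rw [div_mul_eq_mul_div, le_div_iff₀ hx0] at h2
  linarith

lemma orl_jensen {Φ : ℝ → ℝ} (h : IsOrliczFunction Φ) {μ : Measure ℝ} [IsProbabilityMeasure μ]
    (f : ℝ → ℝ) (hf : AEStronglyMeasurable f μ) (hf0 : ∀ᵐ x ∂μ, 0 ≤ f x)
    (hfin : ∫⁻ x, ENNReal.ofReal (Φ (f x)) ∂μ ≠ ⊤) :
    Integrable f μ ∧ ENNReal.ofReal (Φ (∫ x, f x ∂μ)) ≤ ∫⁻ x, ENNReal.ofReal (Φ (f x)) ∂μ := by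
  have hm : AEStronglyMeasurable (fun x => Φ (f x)) μ := by
    refine ((orl_cont h).comp_aestronglyMeasurable hf).congr ?_
    filter_upwards [hf0] with x hx
    simp [max_eq_left hx]
  have hn : 0 ≤ᵐ[μ] fun x => Φ (f x) := by
    filter_upwards [hf0] with x hx
    exact orl_nonneg h hx
  have hi : Integrable (fun x => Φ (f x)) μ :=
    ⟨hm, by rw [hasFiniteIntegral_iff_ofReal hn]; exact hfin.lt_top⟩
  obtain ⟨R, hR, hb⟩ := orl_linear h
  have hfi : Integrable f μ := by
    refine Integrable.mono' ((integrable_const R).add (hi.const_mul R)) hf ?_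
    filter_upwards [hf0] with x hx
    rw [Real.norm_of_nonneg hx]
    exact hb _ hx
  refine ⟨hfi, ?_⟩
  rw [← ofReal_integral_eq_lintegral_ofReal hi hn]
  apply ENNReal.ofReal_le_ofReal
  exact h.convexOn.map_integral_le h.continuousOn isClosed_Ici hf0 hfi hi

lemma pw_meas (a b : ℝ) : Measurable fun x : ℝ => if x ≤ 1 then x ^ a else x ^ b :=
  Measurable.ite measurableSet_Iic (by fun_prop) (by fun_prop)

lemma pw_int {a b : ℝ} (ha : -1 < a) (hb : b < -1) :
    IntegrableOn (fun x : ℝ => if x ≤ 1 then x ^ a else x ^ b) (Ioi 0) ∧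
    ∫ x in Ioi (0:ℝ), (if x ≤ 1 then x ^ a else x ^ b) = 1 / (a + 1) - 1 / (b + 1) := by
  have hu : Ioi (0:ℝ) = Ioc 0 1 ∪ Ioi 1 := (Ioc_union_Ioi_eq_Ioi zero_le_one).symm
  have e1 : EqOn (fun x : ℝ => x ^ a) (fun x : ℝ => if x ≤ 1 then x ^ a else x ^ b) (Ioc 0 1) := by
    intro x hx; simp [hx.2]
  have e2 : EqOn (fun x : ℝ => x ^ b) (fun x : ℝ => if x ≤ 1 then x ^ a else x ^ b) (Ioi 1) := by
    intro x hx; simp [not_le.2 (mem_Ioi.1 hx)]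
  have i1' : IntegrableOn (fun x : ℝ => x ^ a) (Ioc 0 1) :=
    (intervalIntegrable_iff_integrableOn_Ioc_of_le zero_le_one).1
      (intervalIntegral.intervalIntegrable_rpow' ha)
  have i1 := i1'.congr_fun e1 measurableSet_Ioc
  have i2 := (integrableOn_Ioi_rpow_of_lt hb one_pos).congr_fun e2 measurableSet_Ioi
  rw [hu]
  refine ⟨i1.union i2, ?_⟩
  rw [setIntegral_union (by
      rw [Set.disjoint_left]; intro x hx hx'; exact absurd hx.2 (not_le.2 hx')) measurableSet_Ioi i1 i2,
    ← setIntegral_congr_fun measurableSet_Ioc e1, ← setIntegral_congr_fun measurableSet_Ioi e2,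
    ← intervalIntegral.integral_of_le zero_le_one, integral_rpow (Or.inl ha),
    integral_Ioi_rpow_of_lt hb one_pos]
  have : a + 1 ≠ 0 := by linarith
  simp [Real.zero_rpow this]
  ring

lemma scale (H : ℝ → ENNReal) (β : ℝ) {x : ℝ} (hx : 0 < x) :
    ∫⁻ s in Ioi (0:ℝ), ENNReal.ofReal (s ^ (β - 1)) * H (s * x) =
      ENNReal.ofReal (x ^ (-β)) * ∫⁻ s in Ioi (0:ℝ), ENNReal.ofReal (s ^ (β - 1)) * H s := by
  have key := lintegral_image_eq_lintegral_abs_deriv_mul (s := Ioi (0:ℝ)) (f := fun s => s * x)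
    (f' := fun _ => x) measurableSet_Ioi
    (fun s _ => by simpa using ((hasDerivAt_id s).mul_const x).hasDerivWithinAt)
    (fun a _ b _ hab => by simpa [hx.ne'] using hab)
    (fun s => ENNReal.ofReal (s ^ (β - 1)) * H s)
  have him : (fun s => s * x) '' Ioi (0:ℝ) = Ioi 0 := by
    ext r
    constructor
    · rintro ⟨s, hs, rfl⟩; exact mul_pos hs hx
    · intro hr; exact ⟨r / x, div_pos hr hx, div_mul_cancel₀ _ hx.ne'⟩
  rw [him] at key
  rw [key, ← lintegral_const_mul' _ _ ENNReal.ofReal_ne_top]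
  apply setLIntegral_congr_fun measurableSet_Ioi
  intro s hs
  have hs : 0 < s := hs
  dsimp only
  rw [abs_of_pos hx, ← mul_assoc, ← mul_assoc, ← ENNReal.ofReal_mul (by positivity),
    ← ENNReal.ofReal_mul (by positivity)]
  congr 2
  rw [Real.mul_rpow hs.le hx.le]
  have : x ^ (-β) * x * x ^ (β - 1) = 1 := by
    rw [← Real.rpow_add_one hx.ne', ← Real.rpow_add hx]
    simp
  linear_combination (-(s ^ (β - 1))) * this

lemma hardy {Φ : ℝ → ℝ} (h : IsOrliczFunction Φ) {p' q' A c β : ℝ} (hA0 : 0 < A)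
    (hA : ∀ x s : ℝ, 0 < x → 0 ≤ s →
      (x ≤ 1 → Φ (x * s) ≤ A * x ^ p' * Φ s) ∧ (1 ≤ x → Φ (x * s) ≤ A * x ^ q' * Φ s))
    (hp' : 1 < p') (hq' : 1 < q') (hc : 1 < c) (h1 : β < p' * c) (h2 : q' * (c - 1) < β) :
    ∃ C : ℝ, 0 < C ∧ ∀ G F : ℝ → ℝ, Measurable G → (∀ r, 0 < r → 0 ≤ G r) →
      (∀ s, 0 < s → 0 ≤ F s) →
      (∀ s, 0 < s → IntegrableOn (fun x => min 1 (1 / x) * x ^ c / x * G (s * x)) (Ioi 0) →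
        F s ≤ ∫ x in Ioi 0, min 1 (1 / x) * x ^ c / x * G (s * x)) →
      ∫⁻ s in Ioi (0:ℝ), ENNReal.ofReal (s ^ (β - 1)) * ENNReal.ofReal (Φ (F s)) ≤
        ENNReal.ofReal C *
          ∫⁻ s in Ioi (0:ℝ), ENNReal.ofReal (s ^ (β - 1)) * ENNReal.ofReal (Φ (G s)) := by
  obtain ⟨ε, he0, he1, he2, he3⟩ : ∃ ε : ℝ, 0 < ε ∧ ε ≤ 1 ∧ ε * (p' - 1) < p' * c - β ∧
      ε * (q' - 1) < β - q' * (c - 1) := by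
    refine ⟨min 1 (min ((p' * c - β) / (2 * (p' - 1))) ((β - q' * (c - 1)) / (2 * (q' - 1)))),
      ?_, min_le_left _ _, ?_, ?_⟩
    · refine lt_min one_pos (lt_min (div_pos ?_ ?_) (div_pos ?_ ?_)) <;> linarith
    · rw [← lt_div_iff₀ (by linarith)]
      refine ((min_le_right _ _).trans (min_le_left _ _)).trans_lt ?_
      rw [mul_comm 2, ← div_div]
      exact half_lt_self (div_pos (by linarith) (by linarith))
    · rw [← lt_div_iff₀ (by linarith)]
      refine ((min_le_right _ _).trans (min_le_right _ _)).trans_lt ?_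
      rw [mul_comm 2, ← div_div]
      exact half_lt_self (div_pos (by linarith) (by linarith))
  let W : ℝ → ℝ := fun x => ε / 2 * (if x ≤ 1 then x ^ (ε - 1) else x ^ (-ε - 1))
  let m : ℝ → ℝ := fun x => 2 / ε * (if x ≤ 1 then x ^ (c - ε) else x ^ (c - 1 + ε))
  let D : ℝ := A * (2 / ε) ^ q' * A
  let N : ℝ → ℝ := fun x => D * (if x ≤ 1 then x ^ ((c - ε) * p') else x ^ ((c - 1 + ε) * q'))
  let V : ℝ → ℝ := fun x => ε / 2 * D * (if x ≤ 1 then x ^ (ε - 1 + (c - ε) * p' - β)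
    else x ^ (-ε - 1 + (c - 1 + ε) * q' - β))
  have hD : 0 < D := by positivity
  have hWm : Measurable W := (pw_meas _ _).const_mul _
  have hmm : Measurable m := (pw_meas _ _).const_mul _
  have hNm : Measurable N := (pw_meas _ _).const_mul _
  have hW0 : ∀ x, 0 < x → 0 ≤ W x := by
    intro x hx; simp only [W]; split_ifs <;> positivity
  have hm0 : ∀ x, 0 < x → 0 < m x := by
    intro x hx; simp only [m]; split_ifs <;> positivity
  have hN0 : ∀ x, 0 < x → 0 ≤ N x := by
    intro x hx; simp only [N]; split_ifs <;> positivity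
  have hV0 : ∀ x, 0 < x → 0 ≤ V x := by
    intro x hx; simp only [V]; split_ifs <;> positivity
  have hWm_eq : ∀ x, 0 < x → W x * m x = min 1 (1 / x) * x ^ c / x := by
    intro x hx
    simp only [W, m]
    have e : ε / 2 * (2 / ε) = 1 := by field_simp
    split_ifs with hx1
    · rw [min_eq_left ((one_le_div hx).2 hx1), mul_mul_mul_comm, e, ← Real.rpow_add hx, one_mul,
        one_mul, show ε - 1 + (c - ε) = c - 1 by ring, Real.rpow_sub_one hx.ne']
    · rw [min_eq_right ((div_le_one hx).2 (not_le.1 hx1).le), mul_mul_mul_comm, e,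
        ← Real.rpow_add hx, one_mul, show -ε - 1 + (c - 1 + ε) = c - 1 - 1 by ring,
        Real.rpow_sub_one hx.ne', Real.rpow_sub_one hx.ne']
      field_simp
  have hV_eq : ∀ x, 0 < x → W x * N x * x ^ (-β) = V x := by
    intro x hx
    simp only [W, N, V]
    split_ifs with hx1
    · rw [sub_eq_add_neg _ β, Real.rpow_add hx, Real.rpow_add hx]; ring
    · rw [sub_eq_add_neg _ β, Real.rpow_add hx, Real.rpow_add hx]; ring
  have hmN : ∀ x g, 0 < x → 0 ≤ g → Φ (m x * g) ≤ N x * Φ g := by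
    intro x g hx hg
    have hε2 : 1 ≤ 2 / ε := by rw [one_le_div he0]; linarith
    have step : ∀ z, 0 ≤ z → Φ (2 / ε * z) ≤ A * (2 / ε) ^ q' * Φ z := fun z hz =>
      (hA (2 / ε) z (by positivity) hz).2 hε2
    simp only [m, N, D]
    split_ifs with hx1
    · rw [mul_assoc]
      refine (step _ (by positivity)).trans ?_
      have := (hA (x ^ (c - ε)) g (by positivity) hg).1
        (Real.rpow_le_one hx.le hx1 (by linarith))
      rw [← Real.rpow_mul hx.le] at this
      calc _ ≤ A * (2 / ε) ^ q' * (A * x ^ ((c - ε) * p') * Φ g) := by gcongr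
        _ = _ := by ring
    · rw [mul_assoc]
      refine (step _ (by positivity)).trans ?_
      have := (hA (x ^ (c - 1 + ε)) g (by positivity) hg).2
        (Real.one_le_rpow (not_le.1 hx1).le (by linarith))
      rw [← Real.rpow_mul hx.le] at this
      calc _ ≤ A * (2 / ε) ^ q' * (A * x ^ ((c - 1 + ε) * q') * Φ g) := by gcongr
        _ = _ := by ring
  have hWint : IntegrableOn W (Ioi 0) ∧ ∫ x in Ioi 0, W x = 1 := by
    obtain ⟨a, b⟩ := pw_int (a := ε - 1) (b := -ε - 1) (by linarith) (by linarith)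
    refine ⟨a.const_mul _, ?_⟩
    simp only [W]
    rw [integral_const_mul, b]
    simp only [sub_add_cancel]
    field_simp
    ring
  have hVint : IntegrableOn V (Ioi 0) := by
    refine (pw_int ?_ ?_).1.const_mul _ <;> nlinarith
  have hae : ∀ᵐ x ∂(volume.restrict (Ioi (0:ℝ))), 0 < x := ae_restrict_mem measurableSet_Ioi
  let μ : Measure ℝ := (volume.restrict (Ioi 0)).withDensity fun x => ENNReal.ofReal (W x)
  have hμ : IsProbabilityMeasure μ := by
    constructor
    simp only [μ]
    rw [withDensity_apply _ MeasurableSet.univ, Measure.restrict_univ,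
      ← ofReal_integral_eq_lintegral_ofReal hWint.1
        (by filter_upwards [hae] with x hx using hW0 x hx), hWint.2, ENNReal.ofReal_one]
  have hac : μ ≪ volume.restrict (Ioi (0:ℝ)) := withDensity_absolutelyContinuous _ _
  have hΨ : Measurable fun z => ENNReal.ofReal (Φ (max z 0)) :=
    (orl_cont h).measurable.ennreal_ofReal
  have hVI : 0 ≤ ∫ x in Ioi 0, V x :=
    integral_nonneg_of_ae (by filter_upwards [hae] with x hx using hV0 x hx)
  refine ⟨(∫ x in Ioi 0, V x) + 1, by positivity, ?_⟩
  intro G F hGm hG0 hF0 hFG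
  have point : ∀ s, 0 < s → ENNReal.ofReal (Φ (F s)) ≤
      ∫⁻ x in Ioi (0:ℝ), ENNReal.ofReal (W x * N x) * ENNReal.ofReal (Φ (max (G (s * x)) 0)) := by
    intro s hs
    have hG0' : ∀ x, 0 < x → 0 ≤ G (s * x) := fun x hx => hG0 _ (mul_pos hs hx)
    by_cases htop : ∫⁻ x in Ioi (0:ℝ),
        ENNReal.ofReal (W x * N x) * ENNReal.ofReal (Φ (max (G (s * x)) 0)) = ⊤
    · rw [htop]; exact le_top
    have hfm : Measurable fun x => m x * G (s * x) := hmm.mul (hGm.comp (measurable_const_mul s))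
    have hle : ∫⁻ x, ENNReal.ofReal (Φ (m x * G (s * x))) ∂μ ≤ ∫⁻ x in Ioi (0:ℝ),
        ENNReal.ofReal (W x * N x) * ENNReal.ofReal (Φ (max (G (s * x)) 0)) := by
      simp only [μ]
      rw [lintegral_withDensity_eq_lintegral_mul_non_measurable _ hWm.ennreal_ofReal
        (Eventually.of_forall fun _ => ENNReal.ofReal_lt_top)]
      apply setLIntegral_mono_ae' measurableSet_Ioi
      refine Eventually.of_forall fun x hx => ?_
      have hx : 0 < x := hx
      rw [max_eq_left (hG0' x hx), Pi.mul_apply, ENNReal.ofReal_mul (hW0 x hx),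
        mul_assoc (ENNReal.ofReal (W x)), ← ENNReal.ofReal_mul (hN0 x hx)]
      gcongr
      exact hmN x _ hx (hG0' x hx)
    obtain ⟨j1, j2⟩ := orl_jensen h (μ := μ) (fun x => m x * G (s * x))
      hfm.aestronglyMeasurable
      (hac.ae_le (by filter_upwards [hae] with x hx using mul_nonneg (hm0 x hx).le (hG0' x hx)))
      (ne_top_of_le_ne_top htop hle)
    have heq : ∀ᵐ x ∂(volume.restrict (Ioi (0:ℝ))),
        (ENNReal.ofReal (W x)).toReal • (m x * G (s * x)) =
          min 1 (1 / x) * x ^ c / x * G (s * x) := by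
      filter_upwards [hae] with x hx
      rw [ENNReal.toReal_ofReal (hW0 x hx), smul_eq_mul, ← mul_assoc, hWm_eq x hx]
    have i1 : IntegrableOn (fun x => min 1 (1 / x) * x ^ c / x * G (s * x)) (Ioi 0) :=
      ((integrable_withDensity_iff_integrable_smul' hWm.ennreal_ofReal
        (Eventually.of_forall fun _ => ENNReal.ofReal_lt_top)).1 j1).congr heq
    have i2 : ∫ x, m x * G (s * x) ∂μ = ∫ x in Ioi 0, min 1 (1 / x) * x ^ c / x * G (s * x) := by
      simp only [μ]
      rw [integral_withDensity_eq_integral_toReal_smul hWm.ennreal_ofReal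
        (Eventually.of_forall fun _ => ENNReal.ofReal_lt_top)]
      exact integral_congr_ae heq
    have i3 := hFG s hs i1
    rw [← i2] at i3
    refine le_trans (ENNReal.ofReal_le_ofReal ?_) (j2.trans hle)
    exact h.monotoneOn (mem_Ici.2 (hF0 s hs)) (mem_Ici.2 ((hF0 s hs).trans i3)) i3
  calc ∫⁻ s in Ioi (0:ℝ), ENNReal.ofReal (s ^ (β - 1)) * ENNReal.ofReal (Φ (F s))
      ≤ ∫⁻ s in Ioi (0:ℝ), ∫⁻ x in Ioi (0:ℝ), ENNReal.ofReal (s ^ (β - 1)) *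
          (ENNReal.ofReal (W x * N x) * ENNReal.ofReal (Φ (max (G (s * x)) 0))) := by
        apply setLIntegral_mono_ae' measurableSet_Ioi
        refine Eventually.of_forall fun s hs => ?_
        rw [lintegral_const_mul' _ _ ENNReal.ofReal_ne_top]
        gcongr
        exact point s hs
    _ = ∫⁻ x in Ioi (0:ℝ), ∫⁻ s in Ioi (0:ℝ), ENNReal.ofReal (s ^ (β - 1)) *
          (ENNReal.ofReal (W x * N x) * ENNReal.ofReal (Φ (max (G (s * x)) 0))) := by
        apply lintegral_lintegral_swap
        apply Measurable.aemeasurable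
        have q1 : Measurable fun z : ℝ × ℝ => ENNReal.ofReal (z.1 ^ (β - 1)) :=
          (measurable_fst.pow_const _).ennreal_ofReal
        have q2 : Measurable fun z : ℝ × ℝ => ENNReal.ofReal (W z.2 * N z.2) :=
          ((hWm.mul hNm).comp measurable_snd).ennreal_ofReal
        have q3 : Measurable fun z : ℝ × ℝ => ENNReal.ofReal (Φ (max (G (z.1 * z.2)) 0)) :=
          hΨ.comp (hGm.comp (measurable_fst.mul measurable_snd))
        exact q1.mul (q2.mul q3)
    _ = ∫⁻ x in Ioi (0:ℝ), ENNReal.ofReal (V x) *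
          ∫⁻ s in Ioi (0:ℝ), ENNReal.ofReal (s ^ (β - 1)) * ENNReal.ofReal (Φ (G s)) := by
        apply setLIntegral_congr_fun measurableSet_Ioi
        intro x hx
        have hx : 0 < x := hx
        dsimp only
        simp_rw [mul_left_comm _ (ENNReal.ofReal (W x * N x))]
        rw [lintegral_const_mul' _ _ ENNReal.ofReal_ne_top,
          scale (fun z => ENNReal.ofReal (Φ (max (G z) 0))) β hx, ← mul_assoc,
          ← ENNReal.ofReal_mul (mul_nonneg (hW0 x hx) (hN0 x hx)), hV_eq x hx]
        congr 1
        apply setLIntegral_congr_fun measurableSet_Ioi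
        intro s hs
        dsimp only
        rw [max_eq_left (hG0 s hs)]
    _ = ENNReal.ofReal (∫ x in Ioi 0, V x) *
          ∫⁻ s in Ioi (0:ℝ), ENNReal.ofReal (s ^ (β - 1)) * ENNReal.ofReal (Φ (G s)) := by
        rw [lintegral_mul_const _ ((pw_meas _ _).const_mul _).ennreal_ofReal,
          ofReal_integral_eq_lintegral_ofReal hVint
            (by filter_upwards [hae] with x hx using hV0 x hx)]
    _ ≤ _ := by
        gcongr
        linarith

lemma cov_rpow {β : ℝ} (hβ : 0 < β) (f : ℝ → ENNReal) : ∫⁻ t in Ioi (0:ℝ), f t =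
    ENNReal.ofReal β * ∫⁻ s in Ioi (0:ℝ), ENNReal.ofReal (s ^ (β - 1)) * f (s ^ β) := by
  have key := lintegral_image_eq_lintegral_abs_deriv_mul (s := Ioi (0:ℝ)) (f := fun s => s ^ β)
    (f' := fun s => β * s ^ (β - 1)) measurableSet_Ioi
    (fun s hs => (Real.hasDerivAt_rpow_const (Or.inl (ne_of_gt hs))).hasDerivWithinAt)
    (fun a ha b hb hab => (Real.rpow_left_inj (le_of_lt ha) (le_of_lt hb) hβ.ne').1 hab) f
  have him : (fun s => s ^ β) '' Ioi (0:ℝ) = Ioi 0 := by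
    ext r
    constructor
    · rintro ⟨s, hs, rfl⟩; exact Real.rpow_pos_of_pos hs _
    · intro hr
      exact ⟨r ^ β⁻¹, Real.rpow_pos_of_pos hr _, Real.rpow_inv_rpow (le_of_lt hr) hβ.ne'⟩
  rw [him] at key
  rw [key, ← lintegral_const_mul' _ _ ENNReal.ofReal_ne_top]
  apply setLIntegral_congr_fun measurableSet_Ioi
  intro s hs
  have hs : 0 < s := hs
  dsimp only
  rw [abs_of_pos (by positivity), ← mul_assoc, ← ENNReal.ofReal_mul hβ.le]

/-- weighted Φ-moment comparison between the K-functional of `y` and the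
J-functional along any representation `u` of `y`, when `1 < p < p_Φ ≤ q_Φ < q < ∞`. -/
theorem statement7 (Φ : ℝ → ℝ) (hΦ : IsOrliczFunction Φ) (pΦ qΦ : ℝ)
    (hMO : HasMatuzewskaOrliczIndices Φ pΦ qΦ) (p q : ℝ)
    (hp : 1 < p) (hppΦ : p < pΦ) (hpΦqΦ : pΦ ≤ qΦ) (hqΦq : qΦ < q) :
    ∃ C : ℝ, 0 < C ∧
      ∀ (E : Type*) [AddCommGroup E] [Module ℝ E] [TopologicalSpace E] [T2Space E]
        (Y₀ Y₁ : Type*)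
        [NormedAddCommGroup Y₀] [NormedSpace ℝ Y₀] [CompleteSpace Y₀]
        [NormedAddCommGroup Y₁] [NormedSpace ℝ Y₁] [CompleteSpace Y₁]
        (j₀ : Y₀ →L[ℝ] E) (j₁ : Y₁ →L[ℝ] E),
        Function.Injective ⇑j₀ → Function.Injective ⇑j₁ →
        ∀ (y : E) (u : ℝ → E), InSigma j₀ j₁ y → IsRepresentation j₀ j₁ y u →
          (∫⁻ t in Set.Ioi (0:ℝ),
              ENNReal.ofReal (Φ (t ^ (-(1/p)) * Kfun j₀ j₁ (t ^ (1/p - 1/q)) y))) ≤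
            ENNReal.ofReal C *
              ∫⁻ t in Set.Ioi (0:ℝ),
                ENNReal.ofReal
                  (Φ (t ^ (-(1/p)) *
                    Jfun j₀ j₁ (t ^ (1/p - 1/q)) (u (t ^ (1/p - 1/q))))) := by
  have hpq : p < q := by linarith
  have hp0 : 0 < p := by linarith
  have hq0 : 0 < q := by linarith
  have hα : 0 < 1 / p - 1 / q := by
    rw [sub_pos]; exact one_div_lt_one_div_of_lt hp0 hpq
  obtain ⟨p', hp1, hp2⟩ := exists_between hppΦ
  obtain ⟨q', hq1, hq2⟩ := exists_between hqΦq
  obtain ⟨A, hA0, hA⟩ := orl_growth hΦ hMO (p' := p') (q' := q') (by linarith) hp2 (by linarith) hq1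
  obtain ⟨β, hβ⟩ : ∃ β, β = 1 / (1 / p - 1 / q) := ⟨_, rfl⟩
  have hβ0 : 0 < β := by rw [hβ]; positivity
  have hβα : β * (1 / p - 1 / q) = 1 := by rw [hβ]; exact one_div_mul_cancel hα.ne'
  have hc1 : β / p - 1 = β / q := by
    have : β / p - β / q = 1 := by rw [← hβα]; ring
    linarith
  have hβq : 0 < β / q := by positivity
  obtain ⟨C, hC0, hC⟩ := hardy hΦ (c := β / p) (β := β) hA0 hA (by linarith) (by linarith)
    (by linarith)
    (by rw [mul_div_assoc', lt_div_iff₀ hp0]; nlinarith)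
    (by rw [hc1, mul_div_assoc', div_lt_iff₀ hq0]; nlinarith)
  refine ⟨C, hC0, ?_⟩
  intro E _ _ _ _ Y₀ Y₁ _ _ _ _ _ _ j₀ j₁ inj₀ inj₁ y u hy hu
  obtain ⟨u₁, e₁, m₁⟩ := hu.meas₁
  obtain ⟨u₀, e₀, m₀, I₀, S, L⟩ := hu.repr₀
  have cov : ∀ f : ℝ → ENNReal, ∫⁻ t in Ioi (0:ℝ), f t =
      ENNReal.ofReal β * ∫⁻ s in Ioi (0:ℝ), ENNReal.ofReal (s ^ (β - 1)) * f (s ^ β) :=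
    fun f => cov_rpow hβ0 f
  have hpow : ∀ s : ℝ, 0 < s → (s ^ β) ^ (1 / p - 1 / q) = s := by
    intro s hs
    rw [← Real.rpow_mul hs.le, hβα, Real.rpow_one]
  have hpow2 : ∀ s : ℝ, 0 < s → (s ^ β) ^ (-(1 / p)) = s ^ (-(β / p)) := by
    intro s hs
    rw [← Real.rpow_mul hs.le]; congr 1; ring
  let v₀ := m₀.mk u₀
  let v₁ := m₁.mk u₁
  let j : ℝ → ℝ := fun r => max ‖v₀ r‖ (r * ‖v₁ r‖)
  let G : ℝ → ℝ := fun r => r ^ (-(β / p)) * j r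
  have hjm : Measurable j := by
    have a := m₀.stronglyMeasurable_mk.norm.measurable
    have b := m₁.stronglyMeasurable_mk.norm.measurable
    exact a.max (measurable_id.mul b)
  have hGm : Measurable G := (measurable_id.pow_const _).mul hjm
  have hj0 : ∀ r, 0 ≤ j r := fun r => le_max_of_le_left (norm_nonneg _)
  have hj : ∀ᵐ r ∂(volume.restrict (Ioi 0)), j r = max ‖u₀ r‖ (r * ‖u₁ r‖) := by
    filter_upwards [m₀.ae_eq_mk, m₁.ae_eq_mk] with r h0 h1
    simp only [j, v₀, v₁]
    rw [h0, h1]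
  have main := hC G (fun s => s ^ (-(β / p)) * Kfun j₀ j₁ s y) hGm
    (fun r hr => mul_nonneg (by positivity) (hj0 r))
    (fun s hs => mul_nonneg (by positivity) (Kfun_nonneg j₀ j₁ hs.le y)) ?_
  · refine (cov _).trans_le ?_
    rw [cov (fun t => ENNReal.ofReal (Φ (t ^ (-(1/p)) *
      Jfun j₀ j₁ (t ^ (1/p - 1/q)) (u (t ^ (1/p - 1/q)))))), mul_left_comm]
    gcongr ENNReal.ofReal β * ?_
    refine le_trans (le_of_eq ?_) (main.trans (le_of_eq ?_))
    · apply setLIntegral_congr_fun measurableSet_Ioi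
      intro s hs
      dsimp only
      rw [hpow s hs, hpow2 s hs]
    · congr 1
      apply lintegral_congr_ae
      filter_upwards [hj, ae_restrict_mem measurableSet_Ioi] with s h1 hs
      have hs : 0 < s := hs
      rw [hpow s hs, hpow2 s hs, Jfun_eq j₀ j₁ inj₀ inj₁ s (u₀ s) (u₁ s) _ (e₀ s hs) (e₁ s hs)]
      simp only [G]
      rw [h1]
  · intro s hs hint
    have hs' : 0 < s ^ (-(β / p)) := by positivity
    have heq : ∀ x, 0 < x → min 1 (1 / x) * x ^ (β / p) / x * G (s * x) =
        (s ^ (-(β / p)) * s) * (min 1 (s / (s * x)) * j (s * x) / (s * x)) := by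
      intro x hx
      simp only [G]
      rw [Real.mul_rpow hs.le hx.le, Real.rpow_neg hx.le]
      have : 0 < x ^ (β / p) := by positivity
      have e : s / (s * x) = 1 / x := by field_simp
      rw [e]
      field_simp
    have i1 : IntegrableOn (fun r => min 1 (s / r) * j r / r) (Ioi 0) := by
      have := (integrableOn_Ioi_comp_mul_left_iff (fun r => min 1 (s / r) * j r / r) 0 hs).1
      rw [mul_zero] at this
      apply this
      have h3 := (hint.congr_fun (fun x hx => heq x hx) measurableSet_Ioi).const_mul
        (s ^ (-(β / p)) * s)⁻¹
      refine IntegrableOn.congr_fun h3 (fun x _ => ?_) measurableSet_Ioi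
      rw [inv_mul_cancel_left₀ (by positivity)]
    have i2 := K_bound j₀ j₁ y u u₀ u₁ e₁ m₁ e₀ I₀ S L s hs j hj i1
    rw [setIntegral_congr_fun measurableSet_Ioi (fun x hx => heq x hx), integral_const_mul,
      integral_comp_mul_left_Ioi (fun r => min 1 (s / r) * j r / r) 0 hs, mul_zero, smul_eq_mul,
      mul_assoc, mul_inv_cancel_left₀ hs.ne']
    gcongr
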